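/- arXiv:1908.01661 — 2 statements merged into one kernel-verified Lean document; each statement's English description precedes it below -/
import Mathlib

section
/- Let L be a logic and τ(x,ȳ) a parametrized equational translation. Then τ almost defines truth in Mod* L if and only if τ almost defines truth in LMod* L. -/
universe u

/-- An algebraic type (signature): a set of function symbols with finite arities. -/
structure AlgSig : Type (u + 1) where
  F : Type u
  ar : F → ℕ

/-- Terms (formulas) over a signature, with a countably infinite set `ℕ` of variables. -/
inductive Trm (S : AlgSig.{u}) : Type u
  | var : ℕ → Trm S
  | app : (f : S.F) → (Fin (S.ar f) → Trm S) → Trm S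

/-- An algebra of a given signature. -/
structure AlgStr (S : AlgSig.{u}) : Type (u + 1) where
  α : Type u
  op : (f : S.F) → (Fin (S.ar f) → α) → α

variable {S : AlgSig.{u}}

/-- Evaluation of a term in an algebra under a valuation (equivalently, the unique
homomorphism from the term algebra determined by the valuation). -/
def Trm.eval (A : AlgStr S) (v : ℕ → A.α) : Trm S → A.α
  | .var n => v n
  | .app f t => A.op f fun i => Trm.eval A v (t i)

/-- Substitution (an endomorphism of the term algebra). -/
def Trm.subst (σ : ℕ → Trm S) : Trm S → Trm S
  | .var n => σ n
  | .app f t => .app f fun i => Trm.subst σ (t i)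

/-- All variables occurring in the term are `< n`. -/
def Trm.varsLT (n : ℕ) : Trm S → Prop
  | .var m => m < n
  | .app _ t => ∀ i, Trm.varsLT n (t i)

/-- The absolutely free term algebra `Fm`. -/
def TrmAlg (S : AlgSig.{u}) : AlgStr S :=
  ⟨Trm S, Trm.app⟩

/-- A congruence of an algebra. -/
def IsCong (A : AlgStr S) (θ : A.α → A.α → Prop) : Prop :=
  Equivalence θ ∧
    ∀ (f : S.F) (x y : Fin (S.ar f) → A.α), (∀ i, θ (x i) (y i)) → θ (A.op f x) (A.op f y)

/-- A relation is compatible with a subset `F`. -/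
def CompatWith {β : Type u} (θ : β → β → Prop) (F : Set β) : Prop :=
  ∀ a b, θ a b → a ∈ F → b ∈ F

/-- The Leibniz congruence `Ω^A F`: the largest congruence of `A` compatible with `F`
(the union of all congruences compatible with `F`). -/
def Leibniz (A : AlgStr S) (F : Set A.α) : A.α → A.α → Prop :=
  fun a b => ∃ θ, IsCong A θ ∧ CompatWith θ F ∧ θ a b

/-- A matrix `⟨A, F⟩` is reduced if its Leibniz congruence is the identity relation. -/
def IsReducedMatrix (A : AlgStr S) (F : Set A.α) : Prop :=
  ∀ a b, Leibniz A F a b ↔ a = b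

/-- A logic: a structural closure operator on sets of formulas. -/
structure Logic (S : AlgSig.{u}) where
  C : Set (Trm S) → Set (Trm S)
  monotone : ∀ ⦃Γ Δ : Set (Trm S)⦄, Γ ⊆ Δ → C Γ ⊆ C Δ
  extensive : ∀ Γ, Γ ⊆ C Γ
  idem : ∀ Γ, C (C Γ) ⊆ C Γ
  structural : ∀ (σ : ℕ → Trm S) (Γ : Set (Trm S)),
    Trm.subst σ '' C Γ ⊆ C (Trm.subst σ '' Γ)

/-- Deductive filter of a logic over an algebra. -/
def IsDedFilter (Lo : Logic S) (A : AlgStr S) (Fl : Set A.α) : Prop :=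
  ∀ (Γ : Set (Trm S)) (φ : Trm S), φ ∈ Lo.C Γ →
    ∀ v : ℕ → A.α, (∀ γ ∈ Γ, Trm.eval A v γ ∈ Fl) → Trm.eval A v φ ∈ Fl

/-- Theories of a logic: the deductive filters over the term algebra. -/
def Theories (Lo : Logic S) : Set (Set (Trm S)) :=
  {Γ | IsDedFilter Lo (TrmAlg S) Γ}

/-- The deductive filter generated by a set. -/
def FgFilter (Lo : Logic S) (A : AlgStr S) (X : Set A.α) : Set A.α :=
  {a | ∀ G, IsDedFilter Lo A G → X ⊆ G → a ∈ G}

/-- The Suszko congruence of `F` relative to a logic: the intersection of the Leibniz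
congruences of all deductive filters extending `F`. -/
def Suszko (Lo : Logic S) (A : AlgStr S) (F : Set A.α) : A.α → A.α → Prop :=
  fun a b => ∀ G, IsDedFilter Lo A G → F ⊆ G → Leibniz A G a b

/-- Unary polynomial functions of an algebra. -/
def IsUnaryPoly (A : AlgStr S) (p : A.α → A.α) : Prop :=
  ∃ (φ : Trm S) (v : ℕ → A.α), ∀ a, p a = Trm.eval A (Function.update v 0 a) φ

/-- The set of solutions `τ(A)` of a parametrized equational translation `τ(x, ȳ)`,
where the distinguished variable `x` is variable `0` and the parameters are bound by a
universal quantifier. -/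
def solSet (A : AlgStr S) (τ : Set (Trm S × Trm S)) : Set A.α :=
  {a | ∀ (v : ℕ → A.α), ∀ e ∈ τ,
    Trm.eval A (Function.update v 0 a) e.1 = Trm.eval A (Function.update v 0 a) e.2}

/-- `τ` defines truth in `Mod* L`. -/
def DefinesTruth (Lo : Logic S) (τ : Set (Trm S × Trm S)) : Prop :=
  ∀ (A : AlgStr S) (F : Set A.α), IsDedFilter Lo A F → IsReducedMatrix A F →
    solSet A τ = F

/-- `τ` almost defines truth in `Mod* L` (i.e. on its non-almost-trivial members). -/
def AlmostDefinesTruth (Lo : Logic S) (τ : Set (Trm S × Trm S)) : Prop :=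
  ∀ (A : AlgStr S) (F : Set A.α), IsDedFilter Lo A F → IsReducedMatrix A F →
    F.Nonempty → solSet A τ = F

/-- Only the distinguished variable `x` (variable `0`) occurs: no parameters. -/
def Trm.noParams : Trm S → Prop
  | .var n => n = 0
  | .app _ t => ∀ i, Trm.noParams (t i)

/-- An equational translation: a set of equations in the single variable `x`. -/
def IsEqTranslation (τ : Set (Trm S × Trm S)) : Prop :=
  ∀ e ∈ τ, Trm.noParams e.1 ∧ Trm.noParams e.2

/-- The quotient of an algebra by a relation (intended: by a congruence). -/
noncomputable def quotAlg (A : AlgStr S) (r : A.α → A.α → Prop) : AlgStr S :=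
  ⟨Quot r, fun f x => Quot.mk r (A.op f fun i => (x i).out)⟩
variable {S : AlgSig.{u}}

/-- Homomorphisms between algebras of the same signature. -/
structure AlgHomS (A B : AlgStr S) where
  toFun : A.α → B.α
  map_op : ∀ (f : S.F) (x : Fin (S.ar f) → A.α),
    toFun (A.op f x) = B.op f fun i => toFun (x i)

/-- The Leibniz operator is completely order-reflecting on a family `X` of subsets. -/
def ComplOrderReflOn (A : AlgStr S) (X : Set (Set A.α)) : Prop :=
  ∀ (Fam : Set (Set A.α)) (G : Set A.α), Fam ⊆ X → G ∈ X →
    (∀ a b, (∀ F ∈ Fam, Leibniz A F a b) → Leibniz A G a b) → ⋂₀ Fam ⊆ G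

/-- A Fregean logic: every Frege relation `Λ_L Γ` is a congruence of the term algebra. -/
def Fregean (Lo : Logic S) : Prop :=
  ∀ Γ : Set (Trm S),
    IsCong (TrmAlg S) fun φ ψ => ψ ∈ Lo.C (Γ ∪ {φ}) ∧ φ ∈ Lo.C (Γ ∪ {ψ})

/-- A protoalgebraic logic: there is a set `Δ(x,y)` of formulas in two variables with
`∅ ⊢ Δ(x,x)` and `{x} ∪ Δ(x,y) ⊢ y`. -/
def Protoalgebraic (Lo : Logic S) : Prop :=
  ∃ Δ : Set (Trm S), (∀ d ∈ Δ, Trm.varsLT 2 d) ∧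
    (∀ d ∈ Δ, Trm.subst (fun _ => Trm.var 0) d ∈ Lo.C ∅) ∧
    Trm.var 1 ∈ Lo.C ({Trm.var 0} ∪ Δ)

/-- The binary term `a ∧ b` built from a binary function symbol `m`. -/
def binT (m : S.F) (hm : S.ar m = 2) (a b : Trm S) : Trm S :=
  Trm.app m fun i => ![a, b] (Fin.cast hm i)

/-- The binary operation of an algebra induced by a binary function symbol `m`. -/
def binA (A : AlgStr S) (m : S.F) (hm : S.ar m = 2) (a b : A.α) : A.α :=
  A.op m fun i => ![a, b] (Fin.cast hm i)

/-- A subuniverse (universe of a subalgebra). -/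
def Subuniv (A : AlgStr S) (B : Set A.α) : Prop :=
  ∀ (f : S.F) (x : Fin (S.ar f) → A.α), (∀ i, x i ∈ B) → A.op f x ∈ B

/-- The subuniverse generated by a set. -/
def Sg (A : AlgStr S) (X : Set A.α) : Set A.α :=
  ⋂₀ {B | Subuniv A B ∧ X ⊆ B}

/-- A subuniverse is `κ`-generated if it is generated by a subset of cardinality `≤ κ`. -/
def KGenerated (A : AlgStr S) (κ : Cardinal.{u}) (B : Set A.α) : Prop :=
  ∃ X : Set A.α, Cardinal.mk X ≤ κ ∧ Sg A X = B

/-- The subalgebra with universe a given subuniverse. -/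
def subAlg (A : AlgStr S) (B : Set A.α) (hB : Subuniv A B) : AlgStr S :=
  ⟨B, fun f x => ⟨A.op f fun i => (x i).1, hB f _ fun i => (x i).2⟩⟩

/-- The signature expanded with a single new constant symbol `1`. -/
def expSig (S : AlgSig.{u}) : AlgSig.{u} :=
  ⟨S.F ⊕ PUnit, Sum.elim S.ar fun _ => 0⟩

/-- The inclusion of the original terms into the terms of the expanded signature. -/
def Trm.incl : Trm S → Trm (expSig S)
  | .var n => .var n
  | .app f t => .app (Sum.inl f) fun i => Trm.incl (t i)

theorem sub_eval (A : AlgStr S) (v : ℕ → A.α) (σ : ℕ → Trm S) (t : Trm S) :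
    Trm.eval A v (Trm.subst σ t) = Trm.eval A (fun n => Trm.eval A v (σ n)) t := by
  induction t with
  | var n => rfl
  | app f t ih => simp only [Trm.subst, Trm.eval, ih]

theorem eval_trmAlg (σ : ℕ → Trm S) (t : Trm S) :
    Trm.eval (TrmAlg S) σ t = Trm.subst σ t := by
  induction t with
  | var n => rfl
  | app f t ih => simp only [Trm.subst, Trm.eval, ih]; rfl

theorem cong_eval (A : AlgStr S) (θ : A.α → A.α → Prop) (h : IsCong A θ) (v w : ℕ → A.α)
    (hvw : ∀ n, θ (v n) (w n)) (t : Trm S) : θ (Trm.eval A v t) (Trm.eval A w t) := by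
  induction t with
  | var n => exact hvw n
  | app f t ih => exact h.2 f _ _ ih

/-- Indiscernibility by unary polynomials. -/
def PolyInd (A : AlgStr S) (F : Set A.α) (a b : A.α) : Prop :=
  ∀ (φ : Trm S) (v : ℕ → A.α), Trm.eval A (Function.update v 0 a) φ ∈ F ↔
    Trm.eval A (Function.update v 0 b) φ ∈ F

theorem polyInd_step (A : AlgStr S) (F : Set A.α) (f : S.F) (x : Fin (S.ar f) → A.α)
    (i : Fin (S.ar f)) (a b : A.α) (h : PolyInd A F a b) :
    PolyInd A F (A.op f (Function.update x i a)) (A.op f (Function.update x i b)) := by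
  classical
  intro φ v
  let σ : ℕ → Trm S := fun n => if n = 0 then
    Trm.app f (fun j => if j = i then Trm.var 0 else Trm.var (2 * j.1 + 1)) else Trm.var (2 * n)
  let w : ℕ → A.α := fun n => if n % 2 = 0 then v (n / 2) else
    if hn : n / 2 < S.ar f then x ⟨n / 2, hn⟩ else v 0
  have key : ∀ c, Trm.eval A (Function.update w 0 c) (Trm.subst σ φ) =
      Trm.eval A (Function.update v 0 (A.op f (Function.update x i c))) φ := by
    intro c
    rw [sub_eval]
    congr 1
    funext n
    by_cases hn : n = 0
    · subst hn
      simp only [σ, if_true, Trm.eval, Function.update_self]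
      congr 1
      funext j
      by_cases hj : j = i
      · subst hj
        simp [Trm.eval]
      · have h1 : (2 * j.1 + 1) / 2 = j.1 := by omega
        have h2 : (2 * j.1 + 1) % 2 = 1 := by omega
        simp [hj, Trm.eval, w, h1, h2]
    · simp [σ, hn, Trm.eval, w]
  rw [← key, ← key]
  exact h _ _

theorem polyInd_equiv (A : AlgStr S) (F : Set A.α) : Equivalence (PolyInd A F) :=
  ⟨fun _ _ _ => Iff.rfl, fun h φ v => (h φ v).symm,
    fun h k φ v => (h φ v).trans (k φ v)⟩

theorem polyInd_cong (A : AlgStr S) (F : Set A.α) : IsCong A (PolyInd A F) := by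
  classical
  refine ⟨polyInd_equiv A F, fun f x y h => ?_⟩
  have key : ∀ s : Finset (Fin (S.ar f)),
      PolyInd A F (A.op f x) (A.op f (fun j => if j ∈ s then y j else x j)) := by
    intro s
    induction s using Finset.induction_on with
    | empty => simpa using (polyInd_equiv A F).refl _
    | insert i s hi ih =>
      refine (polyInd_equiv A F).trans ih ?_
      have := polyInd_step A F f (fun j => if j ∈ s then y j else x j) i _ _ (h i)
      convert this using 2
      · funext j
        by_cases hj : j = i
        · subst hj; simp [hi]
        · simp [hj]
      · funext j
        by_cases hj : j = i
        · subst hj; simp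
        · simp [hj]
  simpa using key Finset.univ

theorem leibniz_iff (A : AlgStr S) (F : Set A.α) (a b : A.α) :
    Leibniz A F a b ↔ PolyInd A F a b := by
  constructor
  · rintro ⟨θ, hθ, hc, hab⟩ φ v
    have : θ (Trm.eval A (Function.update v 0 a) φ) (Trm.eval A (Function.update v 0 b) φ) := by
      apply cong_eval A θ hθ
      intro n
      by_cases hn : n = 0
      · subst hn; simpa using hab
      · simpa [hn] using hθ.1.refl _
    exact ⟨hc _ _ this, hc _ _ (hθ.1.symm this)⟩
  · intro h
    refine ⟨_, polyInd_cong A F, ?_, h⟩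
    intro c d hcd hc
    have := hcd (Trm.var 0) (fun _ => c)
    simp only [Trm.eval, Function.update_self] at this
    exact this.1 hc

theorem leibniz_cong (A : AlgStr S) (F : Set A.α) : IsCong A (Leibniz A F) := by
  have : Leibniz A F = PolyInd A F := by
    funext a b; exact propext (leibniz_iff A F a b)
  rw [this]; exact polyInd_cong A F

theorem leibniz_compat (A : AlgStr S) (F : Set A.α) : CompatWith (Leibniz A F) F := by
  rintro a b ⟨θ, _, hc, hab⟩ ha
  exact hc _ _ hab ha

theorem mk_eq (A : AlgStr S) (r : A.α → A.α → Prop) (h : IsCong A r) (a b : A.α) :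
    Quot.mk r a = Quot.mk r b ↔ r a b :=
  ⟨fun e => h.1.eqvGen_iff.1 (Quot.eqvGen_exact e), fun e => Quot.sound e⟩

theorem quot_op (A : AlgStr S) (r : A.α → A.α → Prop) (h : IsCong A r) (f : S.F)
    (x : Fin (S.ar f) → A.α) :
    (quotAlg A r).op f (fun i => Quot.mk r (x i)) = Quot.mk r (A.op f x) := by
  refine Quot.sound (h.2 f _ _ fun i => ?_)
  rw [← mk_eq A r h]
  exact Quot.out_eq _

theorem quot_eval (A : AlgStr S) (r : A.α → A.α → Prop) (h : IsCong A r)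
    (v : ℕ → A.α) (t : Trm S) :
    Trm.eval (quotAlg A r) (fun n => Quot.mk r (v n)) t = Quot.mk r (Trm.eval A v t) := by
  induction t with
  | var n => rfl
  | app f t ih =>
    simp only [Trm.eval, ih]
    exact quot_op A r h f _

theorem mem_image_mk (A : AlgStr S) (F : Set A.α) (a : A.α) :
    Quot.mk (Leibniz A F) a ∈ Quot.mk (Leibniz A F) '' F ↔ a ∈ F := by
  constructor
  · rintro ⟨b, hb, e⟩
    exact leibniz_compat A F _ _ ((mk_eq A _ (leibniz_cong A F) _ _).1 e) hb
  · exact fun h => ⟨a, h, rfl⟩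

theorem quot_filter (Lo : Logic S) (A : AlgStr S) (F : Set A.α) (hF : IsDedFilter Lo A F) :
    IsDedFilter Lo (quotAlg A (Leibniz A F)) (Quot.mk (Leibniz A F) '' F) := by
  intro Γ φ hφ v hv
  obtain ⟨w, rfl⟩ : ∃ w : ℕ → A.α, v = fun n => Quot.mk _ (w n) :=
    ⟨fun n => Quot.out (v n), funext fun n => (Quot.out_eq (v n)).symm⟩
  rw [quot_eval A _ (leibniz_cong A F)]
  refine (mem_image_mk A F _).2 (hF Γ φ hφ w fun γ hγ => ?_)
  have := hv γ hγ
  rw [quot_eval A _ (leibniz_cong A F)] at this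
  exact (mem_image_mk A F _).1 this

theorem quot_reduced (A : AlgStr S) (F : Set A.α) :
    IsReducedMatrix (quotAlg A (Leibniz A F)) (Quot.mk (Leibniz A F) '' F) := by
  intro a b
  constructor
  · rintro ⟨θ, hθ, hc, hab⟩
    obtain ⟨a, rfl⟩ := Quot.exists_rep a
    obtain ⟨b, rfl⟩ := Quot.exists_rep b
    refine Quot.sound ⟨fun c d => θ (Quot.mk _ c) (Quot.mk _ d), ⟨⟨fun _ => hθ.1.refl _,
      fun h => hθ.1.symm h, fun h k => hθ.1.trans h k⟩, ?_⟩, ?_, hab⟩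
    · intro f x y h
      have := hθ.2 f _ _ h
      rwa [quot_op A _ (leibniz_cong A F), quot_op A _ (leibniz_cong A F)] at this
    · intro c d hcd hcF
      exact (mem_image_mk A F _).1 (hc _ _ hcd ((mem_image_mk A F _).2 hcF))
  · rintro rfl
    exact (leibniz_cong _ _).1.refl _

theorem preimage_theory (Lo : Logic S) (A : AlgStr S) (F : Set A.α) (hF : IsDedFilter Lo A F)
    (v : ℕ → A.α) : {t | Trm.eval A v t ∈ F} ∈ Theories Lo := by
  intro Γ φ hφ σ hσ
  have e : ∀ t, Trm.eval A v (Trm.eval (TrmAlg S) σ t) =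
      Trm.eval A (fun n => Trm.eval A v (σ n)) t := fun t =>
    (congrArg (Trm.eval A v) (eval_trmAlg σ t)).trans (sub_eval A v σ t)
  have hσ' : ∀ γ ∈ Γ, Trm.eval A (fun n => Trm.eval A v (σ n)) γ ∈ F := fun γ hγ =>
    (e γ) ▸ (show Trm.eval A v (Trm.eval (TrmAlg S) σ γ) ∈ F from hσ γ hγ)
  have := hF Γ φ hφ _ hσ'
  exact (show Trm.eval A v (Trm.eval (TrmAlg S) σ φ) ∈ F from (e φ).symm ▸ this)

theorem update_comp {α β : Type*} (g : α → β) (v : ℕ → α) (t : α) :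
    Function.update (fun n => g (v n)) 0 (g t) = fun n => g (Function.update v 0 t n) := by
  funext n
  by_cases hn : n = 0
  · subst hn; simp
  · simp [hn]

theorem mem_solSet_quot (Γ : Set (Trm S)) (τ : Set (Trm S × Trm S)) (t : Trm S) :
    Quot.mk (Leibniz (TrmAlg S) Γ) t ∈ solSet (quotAlg (TrmAlg S) (Leibniz (TrmAlg S) Γ)) τ ↔
      ∀ σ : ℕ → Trm S, ∀ e ∈ τ, Leibniz (TrmAlg S) Γ
        (Trm.subst (Function.update σ 0 t) e.1) (Trm.subst (Function.update σ 0 t) e.2) := by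
  have hc := leibniz_cong (TrmAlg S) Γ
  have key : ∀ (σ : ℕ → Trm S) (s : Trm S),
      Trm.eval (quotAlg (TrmAlg S) (Leibniz (TrmAlg S) Γ))
        (Function.update (fun n => Quot.mk (Leibniz (TrmAlg S) Γ) (σ n)) 0 (Quot.mk _ t)) s =
      Quot.mk _ (Trm.subst (Function.update σ 0 t) s) := by
    intro σ s
    refine Eq.trans ?_ ((quot_eval (TrmAlg S) _ hc (Function.update σ 0 t) s).trans
      (congrArg (Quot.mk _) (eval_trmAlg _ s)))
    exact congrArg (fun u => Trm.eval (quotAlg (TrmAlg S) (Leibniz (TrmAlg S) Γ)) u s)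
      (update_comp (Quot.mk (Leibniz (TrmAlg S) Γ)) σ t)
  constructor
  · intro h σ e he
    have := h (fun n => Quot.mk _ (σ n)) e he
    exact (mk_eq (TrmAlg S) _ hc _ _).1 ((key σ e.1).symm.trans (this.trans (key σ e.2)))
  · intro h v e he
    obtain ⟨w, rfl⟩ : ∃ w : ℕ → Trm S, v = fun n => Quot.mk _ (w n) :=
      ⟨fun n => Quot.out (v n), funext fun n => (Quot.out_eq (v n)).symm⟩
    exact (key w e.1).trans ((Quot.sound (h w e he)).trans (key w e.2).symm)

/-- a parametrized equational translation almost defines truth in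
`Mod* L` iff it almost defines truth in `LMod* L` (the reductions of the
Lindenbaum–Tarski matrices of non-empty theories). -/
theorem almostDefinesTruth_iff_LModStar {S : AlgSig.{u}} (Lo : Logic S)
    (τ : Set (Trm S × Trm S)) :
    AlmostDefinesTruth Lo τ ↔
      ∀ Γ : Set (Trm S), Γ ∈ Theories Lo → Γ.Nonempty →
        solSet (quotAlg (TrmAlg S) (Leibniz (TrmAlg S) Γ)) τ =
          Quot.mk (Leibniz (TrmAlg S) Γ) '' Γ := by
  constructor
  · intro h Γ hΓ hne
    exact h _ _ (quot_filter Lo (TrmAlg S) Γ hΓ) (quot_reduced (TrmAlg S) Γ) (hne.image _)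
  · intro h A F hF hred hne
    obtain ⟨b, hb⟩ := hne
    ext a
    constructor
    · intro ha
      let v : ℕ → A.α := fun n => if n = 0 then a else b
      have hT := preimage_theory Lo A F hF v
      have h0 := h _ hT ⟨Trm.var 1, by simpa [Trm.eval, v] using hb⟩
      have hm : Quot.mk (Leibniz (TrmAlg S) {t | Trm.eval A v t ∈ F}) (Trm.var 0) ∈
          solSet (quotAlg (TrmAlg S) (Leibniz (TrmAlg S) {t | Trm.eval A v t ∈ F})) τ := by
        refine (mem_solSet_quot _ τ _).2 ?_
        intro σ e he
        refine ⟨fun s t => Trm.eval A v s = Trm.eval A v t, ⟨⟨fun _ => rfl, fun h => h.symm,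
          fun h k => h.trans k⟩, ?_⟩, ?_, ?_⟩
        · intro f x y hxy
          change A.op f _ = A.op f _
          congr 1
          funext i
          exact hxy i
        · intro s t hst hs
          change Trm.eval A v t ∈ F
          rw [← hst]; exact hs
        · have e1 : (fun n => Trm.eval A v (Function.update σ 0 (Trm.var 0) n)) =
              Function.update (fun n => Trm.eval A v (σ n)) 0 a := by
            funext n
            by_cases hn : n = 0
            · subst hn; simp [Trm.eval, v]
            · simp [hn]
          change Trm.eval A v (Trm.subst _ _) = Trm.eval A v (Trm.subst _ _)
          rw [sub_eval, sub_eval, e1]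
          exact ha _ e he
      have := (mem_image_mk (TrmAlg S) _ _).1 ((Set.ext_iff.1 h0 _).1 hm)
      change Trm.eval A v (Trm.var 0) ∈ F at this
      simpa [Trm.eval, v] using this
    · intro ha c e he
      rw [← hred, leibniz_iff]
      intro φ w
      let v : ℕ → A.α := fun n => if n % 2 = 0 then Function.update c 0 a (n / 2) else w (n / 2)
      have hT := preimage_theory Lo A F hF v
      have hv0 : Trm.var 0 ∈ {t | Trm.eval A v t ∈ F} := by
        simpa [Trm.eval, v] using ha
      have h0 := h _ hT ⟨_, hv0⟩
      have hm := (mem_image_mk (TrmAlg S) _ _).2 hv0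
      have hL := (mem_solSet_quot _ τ _).1 ((Set.ext_iff.1 h0 _).2 hm) (fun n => Trm.var (2 * n)) e he
      have hs : Function.update (fun n => Trm.var (2 * n)) 0 (Trm.var 0) =
          (fun n => (Trm.var (2 * n) : Trm S)) := by
        funext n
        by_cases hn : n = 0
        · subst hn; simp
        · simp [hn]
      rw [hs] at hL
      have hL' := (leibniz_iff _ _ _ _).1 hL φ (fun n => Trm.var (2 * n + 1))
      have key : ∀ s : Trm S, Trm.eval A v (Trm.eval (TrmAlg S)
          (Function.update (fun n => (Trm.var (2 * n + 1) : Trm S)) 0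
            (Trm.subst (fun n => Trm.var (2 * n)) s)) φ) =
          Trm.eval A (Function.update w 0 (Trm.eval A (Function.update c 0 a) s)) φ := by
        intro s
        let σ : ℕ → Trm S := Function.update (fun n => (Trm.var (2 * n + 1) : Trm S)) 0
            (Trm.subst (fun n => Trm.var (2 * n)) s)
        refine (congrArg (Trm.eval A v) (eval_trmAlg σ φ)).trans ?_
        rw [sub_eval]
        unfold σ
        congr 1
        funext n
        by_cases hn : n = 0
        · subst hn
          simp only [Function.update_self]
          rw [sub_eval]
          congr 1
          funext m
          simp [Trm.eval, v]
        · have h1 : (2 * n + 1) / 2 = n := by omega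
          have h2 : (2 * n + 1) % 2 = 1 := by omega
          simp [hn, Trm.eval, v, h1, h2]
      rw [← key, ← key]
      exact hL'
end

section
/- If L is a Fregean logic with a protodisjunction ∨, then the parametrized equational translation τ(x,y) := {x ∨ y ≈ x} almost defines truth in Mod* L. -/
universe u

variable {S : AlgSig.{u}}

variable {S : AlgSig.{u}}

theorem aux_eval_subst {S : AlgSig.{u}} (A : AlgStr S) (v : ℕ → A.α) (σ : ℕ → Trm S) (t : Trm S) :
    Trm.eval A v (Trm.subst σ t) = Trm.eval A (fun n => Trm.eval A v (σ n)) t := by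
  induction t with
  | var n => rfl
  | app f t ih => simp only [Trm.subst, Trm.eval, ih]

theorem aux_subst_cong {S : AlgSig.{u}} (θ : Trm S → Trm S → Prop) (h : IsCong (TrmAlg S) θ)
    (σ σ' : ℕ → Trm S) (hσ : ∀ n, θ (σ n) (σ' n)) (t : Trm S) :
    θ (Trm.subst σ t) (Trm.subst σ' t) := by
  induction t with
  | var n => exact hσ n
  | app f t ih => exact h.2 f _ _ ih

/-- Polynomial equivalence modulo `F`. -/
def auxTheta {S : AlgSig.{u}} (A : AlgStr S) (F : Set A.α) (a b : A.α) : Prop :=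
  ∀ (φ : Trm S) (v : ℕ → A.α),
    Trm.eval A (Function.update v 0 a) φ ∈ F ↔ Trm.eval A (Function.update v 0 b) φ ∈ F

theorem aux_step {S : AlgSig.{u}} (A : AlgStr S) (F : Set A.α) (f : S.F)
    (x : Fin (S.ar f) → A.α) (i : Fin (S.ar f)) (a b : A.α) (h : auxTheta A F a b) :
    auxTheta A F (A.op f (Function.update x i a)) (A.op f (Function.update x i b)) := by
  intro φ v
  let σ : ℕ → Trm S := fun n => if n = 0 then
      Trm.app f (fun j => if j = i then Trm.var 0 else Trm.var (j.1 + 1))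
    else Trm.var (n + S.ar f)
  let w : ℕ → A.α := fun n => if hn : n - 1 < S.ar f then x ⟨n - 1, hn⟩ else v (n - S.ar f)
  have key : ∀ c, Trm.eval A (Function.update w 0 c) (Trm.subst σ φ) =
      Trm.eval A (Function.update v 0 (A.op f (Function.update x i c))) φ := by
    intro c
    rw [aux_eval_subst]
    congr 1
    funext n
    by_cases hn : n = 0
    · subst hn
      simp only [σ, if_true, Trm.eval, Function.update_self]
      congr 1
      funext j
      by_cases hj : j = i
      · subst hj
        simp [Trm.eval]
      · simp [hj, Trm.eval, w]
    · have h3 : ¬ (n + S.ar f - 1 < S.ar f) := by omega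
      simp [σ, hn, Trm.eval, w, h3]
  rw [← key, ← key]
  exact h _ _

theorem aux_theta_cong {S : AlgSig.{u}} (A : AlgStr S) (F : Set A.α) :
    IsCong A (auxTheta A F) := by
  refine ⟨⟨fun a φ v => Iff.rfl, fun h φ v => (h φ v).symm,
    fun h h' φ v => (h φ v).trans (h' φ v)⟩, ?_⟩
  intro f x y hxy
  have key : ∀ s : Finset (Fin (S.ar f)),
      auxTheta A F (A.op f x) (A.op f (fun i => if i ∈ s then y i else x i)) := by
    intro s
    induction s using Finset.induction_on with
    | empty => intro φ v; simp
    | insert i s hi ih =>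
      have h := aux_step A F f (fun i => if i ∈ s then y i else x i) i _ _ (hxy i)
      have e1 : Function.update (fun i => if i ∈ s then y i else x i) i (x i)
          = fun i => if i ∈ s then y i else x i := by
        funext j
        by_cases hj : j = i
        · subst hj; simp [hi]
        · simp [hj]
      have e2 : Function.update (fun i => if i ∈ s then y i else x i) i (y i)
          = fun j => if j ∈ insert i s then y j else x j := by
        funext j
        by_cases hj : j = i
        · subst hj; simp
        · simp [hj]
      rw [e1, e2] at h
      exact fun φ v => (ih φ v).trans (h φ v)
  simpa using key Finset.univ

theorem aux_imp {S : AlgSig.{u}} (Lo : Logic S) (hFr : Fregean Lo) (A : AlgStr S) (F : Set A.α)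
    (hF : IsDedFilter Lo A F) (a b : A.α) (ha : a ∈ F) (hb : b ∈ F) (φ : Trm S) (v : ℕ → A.α)
    (h : Trm.eval A (Function.update v 0 a) φ ∈ F) :
    Trm.eval A (Function.update v 0 b) φ ∈ F := by
  let Γ : Set (Trm S) := {Trm.var 0, Trm.var 1}
  let σ : ℕ → ℕ → Trm S := fun k n => if n = 0 then Trm.var k else Trm.var (n + 1)
  have hc := aux_subst_cong _ (hFr Γ) (σ 0) (σ 1) (by
    intro n
    by_cases hn : n = 0
    · simp only [σ, hn, if_true]
      exact ⟨Lo.extensive _ (by simp [Γ]), Lo.extensive _ (by simp [Γ])⟩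
    · simp only [σ, hn, if_false]
      exact ⟨Lo.extensive _ (Or.inr rfl), Lo.extensive _ (Or.inr rfl)⟩) φ
  let w : ℕ → A.α := fun n => if n = 0 then a else if n = 1 then b else v (n - 1)
  have e0 : Trm.eval A w (Trm.subst (σ 0) φ) = Trm.eval A (Function.update v 0 a) φ := by
    rw [aux_eval_subst]
    congr 1
    funext n
    by_cases hn : n = 0
    · simp [σ, hn, Trm.eval, w]
    · simp [σ, hn, Trm.eval, w]
  have e1 : Trm.eval A w (Trm.subst (σ 1) φ) = Trm.eval A (Function.update v 0 b) φ := by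
    rw [aux_eval_subst]
    congr 1
    funext n
    by_cases hn : n = 0
    · simp [σ, hn, Trm.eval, w]
    · simp [σ, hn, Trm.eval, w]
  rw [← e1]
  refine hF _ _ hc.1 w ?_
  rintro γ ((rfl | rfl) | rfl)
  · simpa [Trm.eval, w] using ha
  · simpa [Trm.eval, w] using hb
  · rw [e0]; exact h

/-- if `L` is Fregean with a protodisjunction `∨` (a binary term `d`
with `x ⊢ x ∨ y` and `y ⊢ x ∨ y`), then `τ(x,y) := {x ∨ y ≈ x}` almost defines truth
in `Mod* L`. -/
theorem fregean_protodisjunction {S : AlgSig.{u}} (Lo : Logic S) (hFr : Fregean Lo)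
    (d : Trm S) (hd : Trm.varsLT 2 d)
    (h1 : d ∈ Lo.C {Trm.var 0}) (h2 : d ∈ Lo.C {Trm.var 1}) :
    AlmostDefinesTruth Lo {(d, Trm.var 0)} := by
  intro A F hF hred hne
  ext a
  constructor
  · intro ha
    obtain ⟨c, hc⟩ := hne
    have h := ha (fun _ => c) _ rfl
    have h' : Trm.eval A (Function.update (fun _ => c) 0 a) d ∈ F :=
      hF _ _ h2 _ (by rintro γ rfl; simpa [Trm.eval] using hc)
    simp only [Trm.eval, Function.update_self] at h
    rwa [h] at h'
  · rintro ha v e rfl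
    have h' : Trm.eval A (Function.update v 0 a) d ∈ F :=
      hF _ _ h1 _ (by rintro γ rfl; simpa [Trm.eval] using ha)
    simp only [Trm.eval, Function.update_self]
    refine (hred _ _).1 ⟨auxTheta A F, aux_theta_cong A F, ?_, ?_⟩
    · intro p q h hp
      simpa [Trm.eval] using (h (Trm.var 0) (fun _ => p)).1 (by simpa [Trm.eval] using hp)
    · exact fun φ w => ⟨aux_imp Lo hFr A F hF _ _ h' ha φ w, aux_imp Lo hFr A F hF _ _ ha h' φ w⟩
end
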